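/- Let L be a domain and let E be a quasisober topological space. Every L-valued weakly outer-continuous maxitive measure on the Borel σ-algebra ℬ of E is 𝒬-smooth and saturated. -/

import Mathlib

open Set

universe u v

section OrderDefs
variable {L : Type u} [PartialOrder L]

/-- A filtered (nonempty, downward directed) subset of a poset. -/
def DirFiltered (F : Set L) : Prop :=
  F.Nonempty ∧ ∀ r ∈ F, ∀ s ∈ F, ∃ t ∈ F, t ≤ r ∧ t ≤ s

/-- A filter of a poset: a filtered upper set. -/
def OrdFilter (F : Set L) : Prop :=
  DirFiltered F ∧ ∀ r ∈ F, ∀ s : L, r ≤ s → s ∈ F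

/-- Every filter has an infimum. -/
def FilteredComplete (L : Type u) [PartialOrder L] : Prop :=
  ∀ F : Set L, OrdFilter F → ∃ i : L, IsGLB F i

/-- `s` is way-above `r`: for every filter `F` with an infimum below `r`, `s ∈ F`. -/
def WayAbove (s r : L) : Prop :=
  ∀ F : Set L, OrdFilter F → ∀ i : L, IsGLB F i → i ≤ r → s ∈ F

/-- The poset is continuous: for every `r`, the set of elements way-above `r`
is a filter whose infimum is `r`. -/
def ContinuousPoset (L : Type u) [PartialOrder L] : Prop :=
  ∀ r : L, OrdFilter {s : L | WayAbove s r} ∧ IsGLB {s : L | WayAbove s r} r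

/-- Conditional completeness: every nonempty set bounded above has a supremum. -/
def CondComplete (L : Type u) [PartialOrder L] : Prop :=
  ∀ S : Set L, S.Nonempty → BddAbove S → ∃ m : L, IsLUB S m

end OrderDefs

/-- A domain: a filtered-complete continuous poset with a least element. -/
def DomainPoset (L : Type u) [PartialOrder L] [OrderBot L] : Prop :=
  FilteredComplete L ∧ ContinuousPoset L

section TopDefs
variable {E : Type v} [TopologicalSpace E]

/-- The saturation of a set: intersection of all open sets containing it. -/
def satur (A : Set E) : Set E := ⋂₀ {G : Set E | IsOpen G ∧ A ⊆ G}

/-- A set is saturated if it is an intersection of open sets. -/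
def IsSatur (A : Set E) : Prop :=
  ∃ 𝒢 : Set (Set E), (∀ G ∈ 𝒢, IsOpen G) ∧ A = ⋂₀ 𝒢

/-- The collection 𝒬 of compact saturated subsets. -/
def CompactSat (E : Type v) [TopologicalSpace E] : Set (Set E) :=
  {A : Set E | IsCompact A ∧ IsSatur A}

/-- The Borel σ-algebra generated by open sets and compact saturated sets. -/
def BorelM (E : Type v) [TopologicalSpace E] : MeasurableSpace E :=
  MeasurableSpace.generateFrom ({A : Set E | IsOpen A} ∪ CompactSat E)

/-- Borel subsets for the σ-algebra generated by opens and compact saturated sets. -/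
def IsBorelSet (B : Set E) : Prop := @MeasurableSet E (BorelM E) B

/-- The collection 𝒦 of compact Borel subsets. -/
def CompactBorel (E : Type v) [TopologicalSpace E] : Set (Set E) :=
  {A : Set E | IsBorelSet A ∧ IsCompact A}

/-- `[x]` : the compact Borel set `↑{x} ∩ closure {x}`. -/
def ptClass (x : E) : Set E := satur {x} ∩ closure {x}

end TopDefs

section MeasDefs
variable {L : Type u} {E : Type v} [PartialOrder L] [OrderBot L] [TopologicalSpace E]

/-- An L-valued maxitive measure on the Borel σ-algebra. -/
def Maxitive (ν : Set E → L) : Prop :=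
  ν ∅ = ⊥ ∧ ∀ 𝒞 : Set (Set E), 𝒞.Finite → (∀ B ∈ 𝒞, IsBorelSet B) →
    IsLUB (ν '' 𝒞) (ν (⋃₀ 𝒞))

/-- σ-maxitivity. -/
def SigmaMaxitive (ν : Set E → L) : Prop :=
  Maxitive ν ∧ ∀ 𝒞 : Set (Set E), 𝒞.Countable → (∀ B ∈ 𝒞, IsBorelSet B) →
    IsLUB (ν '' 𝒞) (ν (⋃₀ 𝒞))

/-- Complete maxitivity. -/
def CompletelyMaxitive (ν : Set E → L) : Prop :=
  Maxitive ν ∧ ∀ 𝒞 : Set (Set E), (∀ B ∈ 𝒞, IsBorelSet B) → IsBorelSet (⋃₀ 𝒞) →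
    IsLUB (ν '' 𝒞) (ν (⋃₀ 𝒞))

/-- The set `{ν G : G open, G ⊇ B}`. -/
def outerVals (ν : Set E → L) (B : Set E) : Set L :=
  {l : L | ∃ G : Set E, IsOpen G ∧ B ⊆ G ∧ ν G = l}

/-- `νp` is the map `ν⁺ : B ↦ inf {ν G : G open, G ⊇ B}` on Borel sets. -/
def IsNuPlus (ν νp : Set E → L) : Prop :=
  ∀ B : Set E, IsBorelSet B → IsGLB (outerVals ν B) (νp B)

/-- Outer-continuity. -/
def OuterContinuous (ν : Set E → L) : Prop :=
  ∀ B : Set E, IsBorelSet B → IsGLB (outerVals ν B) (ν B)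

/-- Inner-continuity. -/
def InnerContinuous (ν : Set E → L) : Prop :=
  ∀ B : Set E, IsBorelSet B →
    IsLUB {l : L | ∃ K : Set E, IsBorelSet K ∧ IsCompact K ∧ K ⊆ B ∧ ν (satur K) = l} (ν B)

/-- Regularity: inner- and outer-continuity. -/
def RegularMeasure (ν : Set E → L) : Prop :=
  InnerContinuous ν ∧ OuterContinuous ν

/-- Weak outer-continuity: `ν K = ν⁺ K` for every compact Borel `K`. -/
def WeaklyOuterContinuous (ν : Set E → L) : Prop :=
  ∀ K : Set E, IsBorelSet K → IsCompact K → IsGLB (outerVals ν K) (ν K)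

/-- Weak inner-continuity (relative to a given `ν⁺ = νp`). -/
def WeaklyInnerContinuous (ν νp : Set E → L) : Prop :=
  ∀ G : Set E, IsOpen G →
    IsLUB {l : L | ∃ K : Set E, IsBorelSet K ∧ IsCompact K ∧ K ⊆ G ∧ νp K = l} (ν G)

/-- 𝒜-smoothness. -/
def SmoothWrt (ν : Set E → L) (𝒜 : Set (Set E)) : Prop :=
  ∀ 𝒟 : Set (Set E), 𝒟.Nonempty → 𝒟 ⊆ 𝒜 → DirectedOn (· ⊇ ·) 𝒟 →
    IsGLB (ν '' 𝒟) (ν (⋂₀ 𝒟))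

/-- Saturation of a maxitive measure: `ν K = ν (↑K)` for compact Borel `K`. -/
def SaturatedMeasure (ν : Set E → L) : Prop :=
  ∀ K : Set E, IsBorelSet K → IsCompact K → ν K = ν (satur K)

/-- Tightness: `inf {ν (E ∖ K) : K compact Borel} = 0`. -/
def TightMeasure (ν : Set E → L) : Prop :=
  IsGLB {l : L | ∃ K : Set E, IsBorelSet K ∧ IsCompact K ∧ ν Kᶜ = l} (⊥ : L)

/-- `c` is a cardinal density of `ν`. -/
def IsCardinalDensity (ν : Set E → L) (c : E → L) : Prop :=
  ∀ B : Set E, IsBorelSet B → IsLUB (c '' B) (ν B)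

/-- Upper semicontinuity of a map into the poset. -/
def UscMap (c : E → L) : Prop := ∀ t : L, IsOpen {x : E | WayAbove t (c x)}

/-- Upper compactness of a map into the poset. -/
def UpperCompactMap (c : E → L) : Prop :=
  ∀ t : L, WayAbove t (⊥ : L) → IsCompact {x : E | ¬ WayAbove t (c x)}

/-- Continuity from above along decreasing sequences of Borel sets. -/
def ContinuousFromAbove (ν : Set E → L) : Prop :=
  ∀ B : ℕ → Set E, (∀ n, IsBorelSet (B n)) → (∀ n, B (n + 1) ⊆ B n) →
    IsGLB (Set.range fun n => ν (B n)) (ν (⋂ n, B n))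

/-- An optimal measure: a σ-maxitive measure continuous from above. -/
def OptimalMeasure (ν : Set E → L) : Prop :=
  SigmaMaxitive ν ∧ ContinuousFromAbove ν

/-- `flo` is the regular part `⌊ν⌋` (relative to `νp = ν⁺`):
`⌊ν⌋(B) = sup {ν⁺(K) : K compact Borel, K ⊆ B}`. -/
def RegPartRel (νp flo : Set E → L) : Prop :=
  ∀ B : Set E, IsBorelSet B →
    IsLUB {l : L | ∃ K : Set E, IsBorelSet K ∧ IsCompact K ∧ K ⊆ B ∧ νp K = l} (flo B)

end MeasDefs

section Saturation
variable {E : Type v} [TopologicalSpace E]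

theorem subset_satur (A : Set E) : A ⊆ satur A :=
  subset_sInter fun _ hG => hG.2

theorem IsOpen.satur_subset_iff {A G : Set E} (hG : IsOpen G) : satur A ⊆ G ↔ A ⊆ G :=
  ⟨(subset_satur A).trans, fun h => sInter_subset_of_mem ⟨hG, h⟩⟩

theorem isSatur_satur (A : Set E) : IsSatur (satur A) :=
  ⟨_, fun _ hG => hG.1, rfl⟩

theorem IsSatur.sInter {𝒟 : Set (Set E)} (h : ∀ D ∈ 𝒟, IsSatur D) : IsSatur (⋂₀ 𝒟) := by
  refine ⟨{G | IsOpen G ∧ ⋂₀ 𝒟 ⊆ G}, fun G hG => hG.1,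
    (subset_satur _).antisymm (subset_sInter fun D hD => ?_)⟩
  obtain ⟨𝒢, h𝒢, rfl⟩ := h D hD
  exact subset_sInter fun G hG =>
    sInter_subset_of_mem ⟨h𝒢 G hG, (sInter_subset_of_mem hD).trans (sInter_subset_of_mem hG)⟩

theorem IsSatur.mem_of_specializes {A : Set E} (hA : IsSatur A) {x y : E} (h : x ⤳ y)
    (hy : y ∈ A) : x ∈ A := by
  obtain ⟨𝒢, h𝒢, rfl⟩ := hA
  exact fun G hG => h.mem_open (h𝒢 G hG) (hy G hG)

theorem IsCompact.satur {K : Set E} (hK : IsCompact K) : IsCompact (satur K) := by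
  refine isCompact_of_finite_subcover fun U hU hcov => ?_
  obtain ⟨t, ht⟩ := hK.elim_finite_subcover U hU ((subset_satur K).trans hcov)
  exact ⟨t, (isOpen_biUnion fun i _ => hU i).satur_subset_iff.2 ht⟩

theorem isBorelSet_of_mem_compactSat {A : Set E} (hA : A ∈ CompactSat E) : IsBorelSet A :=
  MeasurableSpace.measurableSet_generateFrom (Or.inr hA)

theorem IsOpen.isBorelSet {G : Set E} (hG : IsOpen G) : IsBorelSet G :=
  MeasurableSpace.measurableSet_generateFrom (Or.inl hG)

/-- A downward directed family of compact sets meeting a closed set has a minimal closed subset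
of it meeting all of them, and that set is irreducible. -/
theorem exists_isIrreducible_subset_inter_nonempty {𝒟 : Set (Set E)} (hne : 𝒟.Nonempty)
    (hc : ∀ D ∈ 𝒟, IsCompact D) (hdir : DirectedOn (· ⊇ ·) 𝒟) {F : Set E} (hF : IsClosed F)
    (hmeet : ∀ D ∈ 𝒟, (D ∩ F).Nonempty) :
    ∃ C ⊆ F, IsClosed C ∧ IsIrreducible C ∧ ∀ D ∈ 𝒟, (D ∩ C).Nonempty := by
  obtain ⟨C, ⟨hCF, hC, hCD⟩, hmin⟩ :=
    zorn_superset {C : Set E | C ⊆ F ∧ IsClosed C ∧ ∀ D ∈ 𝒟, (D ∩ C).Nonempty} (by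
      intro c hcS hchain
      obtain rfl | hcne := c.eq_empty_or_nonempty
      · exact ⟨F, ⟨subset_rfl, hF, hmeet⟩, by simp⟩
      obtain ⟨C₀, hC₀⟩ := hcne
      refine ⟨⋂₀ c, ⟨(sInter_subset_of_mem hC₀).trans (hcS hC₀).1,
        isClosed_sInter fun C hC => (hcS hC).2.1, fun D hD => ?_⟩,
        fun C hC => sInter_subset_of_mem hC⟩
      by_contra hempty
      have : Nonempty c := ⟨⟨C₀, hC₀⟩⟩
      obtain ⟨C, hC⟩ := (hc D hD).elim_directed_family_closed
        (fun C : c => (C : Set E)) (fun C => (hcS C.2).2.1)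
        (by rw [← sInter_eq_iInter]; exact not_nonempty_iff_eq_empty.1 hempty)
        (fun A B => (hchain.total A.2 B.2).elim (fun h => ⟨A, subset_rfl, h⟩)
          fun h => ⟨B, h, subset_rfl⟩)
      exact ((hcS C.2).2.2 D hD).ne_empty hC)
  obtain ⟨D₀, hD₀⟩ := hne
  refine ⟨C, hCF, hC, ⟨(hCD D₀ hD₀).mono inter_subset_right, ?_⟩, hCD⟩
  rw [isPreirreducible_iff_isClosed_union_isClosed]
  intro Z₁ Z₂ hZ₁ hZ₂ hcov
  have key : ∀ Z : Set E, IsClosed Z → (∀ D ∈ 𝒟, (D ∩ (C ∩ Z)).Nonempty) → C ⊆ Z :=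
    fun Z hZ h => (hmin ⟨inter_subset_left.trans hCF, hC.inter hZ, h⟩ inter_subset_left).trans
      inter_subset_right
  by_contra! hcon
  have h₁ := mt (key Z₁ hZ₁) hcon.1
  have h₂ := mt (key Z₂ hZ₂) hcon.2
  push Not at h₁ h₂
  obtain ⟨D₁, hD₁, hE₁⟩ := h₁
  obtain ⟨D₂, hD₂, hE₂⟩ := h₂
  obtain ⟨D, hD, hDD₁, hDD₂⟩ := hdir D₁ hD₁ D₂ hD₂
  obtain ⟨y, hyD, hyC⟩ := hCD D hD
  rcases hcov hyC with hy | hy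
  · exact (hE₁ ▸ (⟨hDD₁ hyD, hyC, hy⟩ : y ∈ D₁ ∩ (C ∩ Z₁)) : y ∈ (∅ : Set E))
  · exact (hE₂ ▸ (⟨hDD₂ hyD, hyC, hy⟩ : y ∈ D₂ ∩ (C ∩ Z₂)) : y ∈ (∅ : Set E))

/-- Quasisober spaces are well-filtered. -/
theorem exists_subset_of_sInter_subset [QuasiSober E] {𝒟 : Set (Set E)} (hne : 𝒟.Nonempty)
    (hsub : 𝒟 ⊆ CompactSat E) (hdir : DirectedOn (· ⊇ ·) 𝒟) {U : Set E} (hU : IsOpen U)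
    (h : ⋂₀ 𝒟 ⊆ U) : ∃ D ∈ 𝒟, D ⊆ U := by
  by_contra! hcon
  obtain ⟨C, hCU, hC, hirr, hCD⟩ := exists_isIrreducible_subset_inter_nonempty hne
    (fun D hD => (hsub hD).1) hdir hU.isClosed_compl
    (fun D hD => inter_compl_nonempty_iff.2 (hcon D hD))
  obtain ⟨x, hx⟩ := QuasiSober.sober hirr hC
  refine hCU hx.mem (h fun D hD => ?_)
  obtain ⟨y, hyD, hyC⟩ := hCD D hD
  exact (hsub hD).2.mem_of_specializes (hx.specializes hyC) hyD

theorem sInter_mem_compactSat [QuasiSober E] {𝒟 : Set (Set E)} (hne : 𝒟.Nonempty)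
    (hsub : 𝒟 ⊆ CompactSat E) (hdir : DirectedOn (· ⊇ ·) 𝒟) : ⋂₀ 𝒟 ∈ CompactSat E := by
  refine ⟨isCompact_of_finite_subcover fun U hU hcov => ?_, .sInter fun D hD => (hsub hD).2⟩
  obtain ⟨D, hD, hDU⟩ := exists_subset_of_sInter_subset hne hsub hdir (isOpen_iUnion hU) hcov
  obtain ⟨t, ht⟩ := (hsub hD).1.elim_finite_subcover U hU hDU
  exact ⟨t, (sInter_subset_of_mem hD).trans ht⟩

end Saturation

theorem Maxitive.mono {L : Type u} {E : Type v} [PartialOrder L] [OrderBot L]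
    [TopologicalSpace E] {ν : Set E → L} (hν : Maxitive ν) {A B : Set E} (hA : IsBorelSet A)
    (hB : IsBorelSet B) (hAB : A ⊆ B) : ν A ≤ ν B := by
  have h := (hν.2 {A, B} (toFinite _) (by simp [hA, hB])).1 (mem_image_of_mem ν (mem_insert A {B}))
  rwa [sUnion_pair, union_eq_self_of_subset_left hAB] at h

/-- on a quasisober space, every weakly outer-continuous maxitive
measure is 𝒬-smooth and saturated. -/
theorem stmt6 {L : Type u} {E : Type v} [PartialOrder L] [OrderBot L]
    [TopologicalSpace E] [QuasiSober E] (hL : DomainPoset L)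
    (ν : Set E → L) (hν : Maxitive ν) (hwoc : WeaklyOuterContinuous ν) :
    SmoothWrt ν (CompactSat E) ∧ SaturatedMeasure ν := by
  refine ⟨fun 𝒟 hne hsub hdir => ⟨?_, fun l hl => ?_⟩, fun K hKB hK => ?_⟩
  · rintro _ ⟨D, hD, rfl⟩
    exact hν.mono (isBorelSet_of_mem_compactSat (sInter_mem_compactSat hne hsub hdir))
      (isBorelSet_of_mem_compactSat (hsub hD)) (sInter_subset_of_mem hD)
  · have hQ := sInter_mem_compactSat hne hsub hdir
    refine (hwoc _ (isBorelSet_of_mem_compactSat hQ) hQ.1).2 ?_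
    rintro _ ⟨G, hG, hQG, rfl⟩
    obtain ⟨D, hD, hDG⟩ := exists_subset_of_sInter_subset hne hsub hdir hG hQG
    exact (hl (mem_image_of_mem ν hD)).trans
      (hν.mono (isBorelSet_of_mem_compactSat (hsub hD)) hG.isBorelSet hDG)
  · have hvals : outerVals ν (satur K) = outerVals ν K := by
      ext l
      exact exists_congr fun G => and_congr_right fun hG =>
        and_congr_left fun _ => hG.satur_subset_iff
    have hS := hwoc (satur K) (isBorelSet_of_mem_compactSat ⟨hK.satur, isSatur_satur K⟩) hK.satur
    exact (hwoc K hKB hK).unique (hvals ▸ hS)
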